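/- arXiv:1107.4104 — 3 statements merged into one kernel-verified Lean document; each statement's English description precedes it below -/
import Mathlib

section
/- Suppose every α_i ≠ 0, G(ς̄) is invertible, and ς̄ ∈ ℝ^m is a critical point of the canonical dual function P^d. Then for x̄ = G(ς̄)⁻¹ F(ς̄) there is no duality gap: P(x̄) = P^d(ς̄). -/
open Matrix

/-- The primal function `P(x) = Σᵢ (αᵢ/2)(½xᵀAᵢx + bᵢᵀx + cᵢ)² + ½xᵀQx − xᵀf`. -/
noncomputable def primalP {n m : ℕ} (Q : Matrix (Fin n) (Fin n) ℝ)
    (A : Fin m → Matrix (Fin n) (Fin n) ℝ) (f : Fin n → ℝ) (b : Fin m → Fin n → ℝ)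
    (c α : Fin m → ℝ) (x : Fin n → ℝ) : ℝ :=
  (∑ i, α i / 2 * ((1 / 2) * (x ⬝ᵥ (A i).mulVec x) + b i ⬝ᵥ x + c i) ^ 2)
    + (1 / 2) * (x ⬝ᵥ Q.mulVec x) - x ⬝ᵥ f

/-- `F(ς) = f − Σᵢ ςᵢ bᵢ`. -/
noncomputable def Fvec {n m : ℕ} (f : Fin n → ℝ) (b : Fin m → Fin n → ℝ)
    (ς : Fin m → ℝ) : Fin n → ℝ :=
  f - ∑ i, ς i • b i

/-- `G(ς) = Q + Σᵢ ςᵢ Aᵢ`. -/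
noncomputable def Gmat {n m : ℕ} (Q : Matrix (Fin n) (Fin n) ℝ)
    (A : Fin m → Matrix (Fin n) (Fin n) ℝ) (ς : Fin m → ℝ) : Matrix (Fin n) (Fin n) ℝ :=
  Q + ∑ i, ς i • A i

/-- The canonical dual function
`P^d(ς) = Σᵢ (cᵢςᵢ − ςᵢ²/(2αᵢ)) − ½ F(ς)ᵀ G(ς)⁻¹ F(ς)`. -/
noncomputable def dualP {n m : ℕ} (Q : Matrix (Fin n) (Fin n) ℝ)
    (A : Fin m → Matrix (Fin n) (Fin n) ℝ) (f : Fin n → ℝ) (b : Fin m → Fin n → ℝ)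
    (c α : Fin m → ℝ) (ς : Fin m → ℝ) : ℝ :=
  (∑ i, (c i * ς i - ς i ^ 2 / (2 * α i)))
    - (1 / 2) * (Fvec f b ς ⬝ᵥ (Gmat Q A ς)⁻¹.mulVec (Fvec f b ς))

/-- The Gao–Strang complementary function
`Ξ(x,ς) = Σᵢ [(½xᵀAᵢx + bᵢᵀx + cᵢ)ςᵢ − ςᵢ²/(2αᵢ)] + ½xᵀQx − xᵀf`. -/
noncomputable def GaoStrangXi {n m : ℕ} (Q : Matrix (Fin n) (Fin n) ℝ)
    (A : Fin m → Matrix (Fin n) (Fin n) ℝ) (f : Fin n → ℝ) (b : Fin m → Fin n → ℝ)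
    (c α : Fin m → ℝ) (x : Fin n → ℝ) (ς : Fin m → ℝ) : ℝ :=
  (∑ i, (((1 / 2) * (x ⬝ᵥ (A i).mulVec x) + b i ⬝ᵥ x + c i) * ς i - ς i ^ 2 / (2 * α i)))
    + (1 / 2) * (x ⬝ᵥ Q.mulVec x) - x ⬝ᵥ f

section helpers

attribute [local instance] Matrix.linftyOpNormedRing Matrix.linftyOpNormedAlgebra

lemma ndg_inv_diff {n m : ℕ} (Q : Matrix (Fin n) (Fin n) ℝ)
    (A : Fin m → Matrix (Fin n) (Fin n) ℝ) (s : Fin m → ℝ) (hG : IsUnit (Gmat Q A s))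
    (j k : Fin n) : DifferentiableAt ℝ (fun t => (Gmat Q A t)⁻¹ j k) s := by
  have h1 : DifferentiableAt ℝ (fun t => Gmat Q A t) s := by
    unfold Gmat
    fun_prop
  obtain ⟨u, hu⟩ := hG
  have h2 : DifferentiableAt ℝ (Ring.inverse : Matrix (Fin n) (Fin n) ℝ → _) (Gmat Q A s) := by
    rw [← hu]
    exact (hasFDerivAt_ringInverse (𝕜 := ℝ) u).differentiableAt
  have h3 : DifferentiableAt ℝ (fun t => (Gmat Q A t)⁻¹) s := by
    have := h2.comp s h1
    refine this.congr_of_eventuallyEq (Filter.Eventually.of_forall fun t => ?_)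
    simp [Matrix.nonsing_inv_eq_ringInverse]
  have h4 : DifferentiableAt ℝ (LinearMap.toContinuousLinearMap
      (Matrix.entryLinearMap ℝ ℝ j k)) ((Gmat Q A s)⁻¹) :=
    ContinuousLinearMap.differentiableAt _
  have h5 := h4.comp s h3
  exact h5

end helpers

lemma ndg_x_diff {n m : ℕ} (Q : Matrix (Fin n) (Fin n) ℝ)
    (A : Fin m → Matrix (Fin n) (Fin n) ℝ) (f : Fin n → ℝ) (b : Fin m → Fin n → ℝ)
    (s : Fin m → ℝ) (hG : IsUnit (Gmat Q A s)) :
    DifferentiableAt ℝ (fun t => (Gmat Q A t)⁻¹.mulVec (Fvec f b t)) s := by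
  rw [differentiableAt_pi]
  intro j
  have h2 : DifferentiableAt ℝ (fun t => Fvec f b t) s := by
    unfold Fvec
    fun_prop
  rw [differentiableAt_pi] at h2
  have h : DifferentiableAt ℝ (fun t => ∑ k, (Gmat Q A t)⁻¹ j k * Fvec f b t k) s :=
    DifferentiableAt.fun_sum fun k _ => (ndg_inv_diff Q A s hG j k).fun_mul (h2 k)
  exact h

lemma ndg_dual_diff {n m : ℕ} (Q : Matrix (Fin n) (Fin n) ℝ)
    (A : Fin m → Matrix (Fin n) (Fin n) ℝ) (f : Fin n → ℝ) (b : Fin m → Fin n → ℝ)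
    (c α : Fin m → ℝ) (s : Fin m → ℝ) (hG : IsUnit (Gmat Q A s)) :
    DifferentiableAt ℝ (dualP Q A f b c α) s := by
  have h := ndg_x_diff Q A f b s hG
  rw [differentiableAt_pi] at h
  unfold dualP
  unfold dotProduct
  have h2 : DifferentiableAt ℝ (fun t => Fvec f b t) s := by
    unfold Fvec
    fun_prop
  rw [differentiableAt_pi] at h2
  simp only [div_eq_mul_inv]
  fun_prop

lemma ndg_dot {n : ℕ} {u v : ℝ → Fin n → ℝ} {u' v' : Fin n → ℝ} {t : ℝ}
    (hu : HasDerivAt u u' t) (hv : HasDerivAt v v' t) :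
    HasDerivAt (fun t => u t ⬝ᵥ v t) (u' ⬝ᵥ v t + u t ⬝ᵥ v') t := by
  rw [hasDerivAt_pi] at hu hv
  unfold dotProduct
  rw [← Finset.sum_add_distrib]
  exact HasDerivAt.fun_sum fun i _ => (hu i).fun_mul (hv i)

lemma ndg_crit {n m : ℕ} (Q : Matrix (Fin n) (Fin n) ℝ)
    (A : Fin m → Matrix (Fin n) (Fin n) ℝ) (f : Fin n → ℝ) (b : Fin m → Fin n → ℝ)
    (c α : Fin m → ℝ) (hQ : Q.IsSymm) (hA : ∀ i, (A i).IsSymm)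
    (s : Fin m → ℝ) (hG : IsUnit (Gmat Q A s))
    (hcrit : fderiv ℝ (dualP Q A f b c α) s = 0) (x : Fin n → ℝ)
    (hx : x = (Gmat Q A s)⁻¹.mulVec (Fvec f b s)) (i : Fin m) :
    c i - s i / α i + b i ⬝ᵥ x + (1 / 2) * (x ⬝ᵥ (A i).mulVec x) = 0 := by
  -- the line through `s` in direction `i`
  let p : ℝ → Fin m → ℝ := fun t => s + t • Pi.single i 1
  have hp0 : p 0 = s := by simp [p]
  have hp : HasDerivAt p (Pi.single i 1) 0 := by
    have := ((hasDerivAt_id (0 : ℝ)).smul_const (Pi.single i (1 : ℝ) : Fin m → ℝ)).const_add s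
    simpa [p] using this
  have hFp : ∀ t, Fvec f b (p t) = Fvec f b s - t • b i := by
    intro t
    simp [p, Fvec, add_smul, Finset.sum_add_distrib, Pi.single_apply, sub_sub]
  have hGp : ∀ t, Gmat Q A (p t) = Gmat Q A s + t • A i := by
    intro t
    simp [p, Gmat, add_smul, Finset.sum_add_distrib, Pi.single_apply, add_assoc]
  have hF : HasDerivAt (fun t => Fvec f b (p t)) (-b i) 0 := by
    simp only [hFp]
    simpa using ((hasDerivAt_id (0 : ℝ)).smul_const (b i)).const_sub (Fvec f b s)
  let X : ℝ → Fin n → ℝ := fun t => (Gmat Q A (p t))⁻¹.mulVec (Fvec f b (p t))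
  have hX0 : X 0 = x := by simp only [X, hp0, hx]
  obtain ⟨x', hX⟩ : ∃ x', HasDerivAt X x' 0 := by
    have h := ndg_x_diff Q A f b s hG
    rw [← hp0] at h
    exact ⟨_, (h.comp (0 : ℝ) hp.differentiableAt).hasDerivAt⟩
  have hGs : (Gmat Q A s).IsSymm := by
    unfold Gmat Matrix.IsSymm
    simp [Matrix.transpose_sum, hQ.eq, fun i => (hA i).eq]
  have hGx : (Gmat Q A s).mulVec x = Fvec f b s := by
    rw [hx, Matrix.mulVec_mulVec, Matrix.mul_nonsing_inv _ ((Matrix.isUnit_iff_isUnit_det _).1 hG),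
      Matrix.one_mulVec]
  have hsym : ∀ v, x ⬝ᵥ (Gmat Q A s).mulVec v = Fvec f b s ⬝ᵥ v := by
    intro v
    rw [Matrix.dotProduct_mulVec, ← Matrix.mulVec_transpose, hGs.eq, hGx]
  -- the identity `x · G(t) X(t) = x · F(t)` near zero
  have hunit : ∀ᶠ t in nhds (0 : ℝ), (Gmat Q A s + t • A i).det ≠ 0 := by
    have hc : Continuous fun t : ℝ => (Gmat Q A s + t • A i).det := by fun_prop
    apply hc.continuousAt.eventually_ne
    simpa using ((Matrix.isUnit_iff_isUnit_det _).1 hG).ne_zero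
  have hid : ∀ᶠ t in nhds (0 : ℝ),
      Fvec f b s ⬝ᵥ X t + t * (x ⬝ᵥ (A i).mulVec (X t)) = x ⬝ᵥ Fvec f b (p t) := by
    filter_upwards [hunit] with t ht
    have : (Gmat Q A (p t)).mulVec (X t) = Fvec f b (p t) := by
      simp only [X]
      rw [Matrix.mulVec_mulVec, Matrix.mul_nonsing_inv _ (by rw [hGp]; exact ht.isUnit),
        Matrix.one_mulVec]
    rw [← this, hGp, Matrix.add_mulVec, dotProduct_add, hsym, Matrix.smul_mulVec, dotProduct_smul,
      smul_eq_mul]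
  have hAX : HasDerivAt (fun t => (A i).mulVec (X t)) ((A i).mulVec x') 0 :=
    ((A i).mulVecLin.toContinuousLinearMap.hasFDerivAt).comp_hasDerivAt (0 : ℝ) hX
  have d1 := (ndg_dot (hasDerivAt_const (0 : ℝ) (Fvec f b s)) hX).fun_add
    ((hasDerivAt_id (0 : ℝ)).fun_mul (ndg_dot (hasDerivAt_const (0 : ℝ) x) hAX))
  have d2 := ndg_dot (hasDerivAt_const (0 : ℝ) x) hF
  have e1 := d1.unique (d2.congr_of_eventuallyEq hid)
  have hq := ndg_dot hF hX
  have hD : HasDerivAt (fun t => dualP Q A f b c α (p t)) 0 0 := by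
    have h := (ndg_dual_diff Q A f b c α s hG).hasFDerivAt
    rw [hcrit, ← hp0] at h
    exact h.comp_hasDerivAt (0 : ℝ) hp
  have hpk : ∀ k, HasDerivAt (fun t => p t k) ((Pi.single i 1 : Fin m → ℝ) k) 0 :=
    hasDerivAt_pi.1 hp
  have hsum : HasDerivAt (fun t => ∑ k, (c k * p t k - p t k ^ 2 / (2 * α k)))
      (∑ k, (c k * (Pi.single i 1 : Fin m → ℝ) k
        - (2 * p 0 k * (Pi.single i 1 : Fin m → ℝ) k) / (2 * α k))) 0 := by
    refine HasDerivAt.fun_sum fun k _ => ?_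
    have := ((hpk k).const_mul (c k)).fun_sub (((hpk k).fun_pow 2).div_const (2 * α k))
    simpa using this
  have e2 := hD.unique (hsum.fun_sub (hq.const_mul (1 / 2)))
  have e3 : (∑ k, (c k * (Pi.single i 1 : Fin m → ℝ) k
        - (2 * p 0 k * (Pi.single i 1 : Fin m → ℝ) k) / (2 * α k))) = c i - s i / α i := by
    rw [Finset.sum_eq_single i]
    · simp [hp0, mul_div_mul_left]
    · intro k _ hk
      simp [hk]
    · simp
  rw [e3] at e2
  simp only [hX0, hp0, id, zero_dotProduct, neg_dotProduct, dotProduct_neg, zero_add, zero_mul,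
    one_mul, add_zero] at e1 e2
  rw [dotProduct_comm x (b i)] at e1
  linarith

/-- No duality gap: if every `αᵢ ≠ 0`, `G(ς̄)` is invertible and `ς̄` is a critical point of
the canonical dual function `P^d`, then for `x̄ = G(ς̄)⁻¹ F(ς̄)` one has `P(x̄) = P^d(ς̄)`. -/
theorem no_duality_gap {n m : ℕ} (Q : Matrix (Fin n) (Fin n) ℝ)
    (A : Fin m → Matrix (Fin n) (Fin n) ℝ) (f : Fin n → ℝ) (b : Fin m → Fin n → ℝ)
    (c α : Fin m → ℝ) (hQ : Q.IsSymm) (hA : ∀ i, (A i).IsSymm)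
    (hα : ∀ i, α i ≠ 0) (ςb : Fin m → ℝ)
    (hG : IsUnit (Gmat Q A ςb))
    (hcrit : fderiv ℝ (dualP Q A f b c α) ςb = 0) :
    primalP Q A f b c α ((Gmat Q A ςb)⁻¹.mulVec (Fvec f b ςb)) = dualP Q A f b c α ςb := by
  have hcr := ndg_crit Q A f b c α hQ hA ςb hG hcrit _ rfl
  have hGx : (Gmat Q A ςb).mulVec ((Gmat Q A ςb)⁻¹.mulVec (Fvec f b ςb)) = Fvec f b ςb := by
    rw [Matrix.mulVec_mulVec, Matrix.mul_nonsing_inv _ ((Matrix.isUnit_iff_isUnit_det _).1 hG),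
      Matrix.one_mulVec]
  unfold primalP dualP
  generalize (Gmat Q A ςb)⁻¹.mulVec (Fvec f b ςb) = x at *
  have h1 : Fvec f b ςb ⬝ᵥ x = x ⬝ᵥ f - ∑ i, ςb i * (b i ⬝ᵥ x) := by
    simp [Fvec, sub_dotProduct, sum_dotProduct, dotProduct_comm x f]
  have h2 : Fvec f b ςb ⬝ᵥ x = x ⬝ᵥ Q.mulVec x + ∑ i, ςb i * (x ⬝ᵥ (A i).mulVec x) := by
    rw [← hGx, dotProduct_comm]
    simp [Gmat, Matrix.add_mulVec, Matrix.sum_mulVec, dotProduct_add, dotProduct_sum,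
      Matrix.smul_mulVec]
  have h3 : ∑ i, α i / 2 * ((1 / 2) * (x ⬝ᵥ (A i).mulVec x) + b i ⬝ᵥ x + c i) ^ 2
      = ∑ i, (c i * ςb i - ςb i ^ 2 / (2 * α i)) + ∑ i, ςb i * (b i ⬝ᵥ x)
        + (1 / 2) * ∑ i, ςb i * (x ⬝ᵥ (A i).mulVec x) := by
    rw [Finset.mul_sum, ← Finset.sum_add_distrib, ← Finset.sum_add_distrib]
    refine Finset.sum_congr rfl fun i _ => ?_
    have hc : c i = ςb i / α i - b i ⬝ᵥ x - (1 / 2) * (x ⬝ᵥ (A i).mulVec x) := by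
      linarith [hcr i]
    have := hα i
    rw [hc]
    field_simp
    ring
  rw [h3]
  linarith
end

section
/- Suppose every α_i > 0, ς̄ ∈ ℝ^m is a critical point of the canonical dual function P^d, and G(ς̄) is positive definite. Then ς̄ is a global maximizer of P^d over S_a⁺ = {ς ∈ ℝ^m : G(ς) is positive definite}: for every ς ∈ S_a⁺, P^d(ς) ≤ P^d(ς̄). -/
open Matrix

/-- The complementary function at a fixed `x`, in separable form. -/
noncomputable def hsep {n m : ℕ} (Q : Matrix (Fin n) (Fin n) ℝ)
    (A : Fin m → Matrix (Fin n) (Fin n) ℝ) (f : Fin n → ℝ) (b : Fin m → Fin n → ℝ)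
    (c α : Fin m → ℝ) (x : Fin n → ℝ) (ς : Fin m → ℝ) : ℝ :=
  (∑ i, ((c i + b i ⬝ᵥ x + (1 / 2) * (x ⬝ᵥ (A i).mulVec x)) * ς i - ς i ^ 2 / (2 * α i)))
    + ((1 / 2) * (x ⬝ᵥ Q.mulVec x) - x ⬝ᵥ f)

theorem Gmat_symm {n m : ℕ} (Q : Matrix (Fin n) (Fin n) ℝ)
    (A : Fin m → Matrix (Fin n) (Fin n) ℝ) (hQ : Q.IsSymm) (hA : ∀ i, (A i).IsSymm)
    (ς : Fin m → ℝ) : (Gmat Q A ς)ᵀ = Gmat Q A ς := by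
  unfold Gmat
  rw [Matrix.transpose_add, Matrix.transpose_sum, hQ.eq]
  congr 1
  exact Finset.sum_congr rfl fun i _ => by rw [Matrix.transpose_smul, (hA i).eq]

theorem dual_eq {n m : ℕ} (Q : Matrix (Fin n) (Fin n) ℝ)
    (A : Fin m → Matrix (Fin n) (Fin n) ℝ) (f : Fin n → ℝ) (b : Fin m → Fin n → ℝ)
    (c α : Fin m → ℝ) (hQ : Q.IsSymm) (hA : ∀ i, (A i).IsSymm)
    (x : Fin n → ℝ) (ς : Fin m → ℝ) (hdet : IsUnit (Gmat Q A ς).det) :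
    dualP Q A f b c α ς = hsep Q A f b c α x ς -
      (1 / 2) * ((x - (Gmat Q A ς)⁻¹.mulVec (Fvec f b ς)) ⬝ᵥ
        (Gmat Q A ς).mulVec (x - (Gmat Q A ς)⁻¹.mulVec (Fvec f b ς))) := by
  have hs := Gmat_symm Q A hQ hA ς
  have h1 : x ⬝ᵥ (Gmat Q A ς).mulVec x
      = x ⬝ᵥ Q.mulVec x + ∑ i, ς i * (x ⬝ᵥ (A i).mulVec x) := by
    simp [Gmat, Matrix.add_mulVec, Matrix.sum_mulVec, Matrix.smul_mulVec, dotProduct_add,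
      dotProduct_sum, dotProduct_smul]
  have h2 : x ⬝ᵥ Fvec f b ς = x ⬝ᵥ f - ∑ i, ς i * (b i ⬝ᵥ x) := by
    rw [Fvec, dotProduct_sub, dotProduct_sum]
    simp only [dotProduct_comm x, smul_dotProduct, smul_eq_mul]
  have h3 : hsep Q A f b c α x ς = (∑ i, (c i * ς i - ς i ^ 2 / (2 * α i)))
      + (1 / 2) * (x ⬝ᵥ (Gmat Q A ς).mulVec x) - x ⬝ᵥ Fvec f b ς := by
    rw [h1, h2]
    unfold hsep
    have : ∑ i, ((c i + b i ⬝ᵥ x + (1 / 2) * (x ⬝ᵥ (A i).mulVec x)) * ς i - ς i ^ 2 / (2 * α i))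
      = (∑ i, (c i * ς i - ς i ^ 2 / (2 * α i))) + (∑ i, ς i * (b i ⬝ᵥ x))
        + (1 / 2) * ∑ i, ς i * (x ⬝ᵥ (A i).mulVec x) := by
      rw [Finset.mul_sum, ← Finset.sum_add_distrib, ← Finset.sum_add_distrib]
      exact Finset.sum_congr rfl fun i _ => by ring
    rw [this]; ring
  have h4 : (Gmat Q A ς).mulVec ((Gmat Q A ς)⁻¹.mulVec (Fvec f b ς)) = Fvec f b ς := by
    rw [Matrix.mulVec_mulVec, Matrix.mul_nonsing_inv _ hdet, Matrix.one_mulVec]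
  rw [h3]
  unfold dualP
  generalize (Gmat Q A ς)⁻¹.mulVec (Fvec f b ς) = y at *
  have h5 : y ⬝ᵥ (Gmat Q A ς).mulVec x = x ⬝ᵥ Fvec f b ς := by
    rw [← h4, Matrix.dotProduct_mulVec, ← Matrix.mulVec_transpose, hs, dotProduct_comm]
  rw [Matrix.mulVec_sub, sub_dotProduct, dotProduct_sub, dotProduct_sub, h4, h5,
    dotProduct_comm y]
  ring

section
attribute [local instance] Matrix.linftyOpNormedRing Matrix.linftyOpNormedAlgebra

theorem differentiable_Gmat {n m : ℕ} (Q : Matrix (Fin n) (Fin n) ℝ)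
    (A : Fin m → Matrix (Fin n) (Fin n) ℝ) : Differentiable ℝ (Gmat Q A) := by
  unfold Gmat
  fun_prop

theorem differentiableAt_Ginv {n m : ℕ} (Q : Matrix (Fin n) (Fin n) ℝ)
    (A : Fin m → Matrix (Fin n) (Fin n) ℝ) (ς : Fin m → ℝ) (h : IsUnit (Gmat Q A ς)) :
    DifferentiableAt ℝ (fun s => (Gmat Q A s)⁻¹) ς := by
  obtain ⟨u, hu⟩ := h
  have h1 : DifferentiableAt ℝ (Ring.inverse : Matrix (Fin n) (Fin n) ℝ → _) (Gmat Q A ς) := by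
    rw [← hu]; exact differentiableAt_inverse u.isUnit
  have := h1.comp ς (differentiable_Gmat Q A ς)
  simp only [Matrix.nonsing_inv_eq_ringInverse]
  exact this

theorem entry_diff {n m : ℕ} {M : (Fin m → ℝ) → Matrix (Fin n) (Fin n) ℝ} {ς : Fin m → ℝ}
    (h : DifferentiableAt ℝ M ς) (i j : Fin n) : DifferentiableAt ℝ (fun s => M s i j) ς := by
  let L : Matrix (Fin n) (Fin n) ℝ →ₗ[ℝ] ℝ := Matrix.entryLinearMap ℝ ℝ i j
  exact (LinearMap.toContinuousLinearMap L).differentiableAt.comp ς h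

theorem entry_G {n m : ℕ} (Q : Matrix (Fin n) (Fin n) ℝ)
    (A : Fin m → Matrix (Fin n) (Fin n) ℝ) (ς : Fin m → ℝ) (i j : Fin n) :
    DifferentiableAt ℝ (fun s => Gmat Q A s i j) ς := entry_diff (differentiable_Gmat Q A ς) i j

theorem entry_Ginv {n m : ℕ} (Q : Matrix (Fin n) (Fin n) ℝ)
    (A : Fin m → Matrix (Fin n) (Fin n) ℝ) (ς : Fin m → ℝ) (h : IsUnit (Gmat Q A ς))
    (i j : Fin n) :
    DifferentiableAt ℝ (fun s => (Gmat Q A s)⁻¹ i j) ς :=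
  entry_diff (differentiableAt_Ginv Q A ς h) i j

theorem eventually_unit {n m : ℕ} (Q : Matrix (Fin n) (Fin n) ℝ)
    (A : Fin m → Matrix (Fin n) (Fin n) ℝ) (ς : Fin m → ℝ) (h : IsUnit (Gmat Q A ς)) :
    ∀ᶠ s in nhds ς, IsUnit (Gmat Q A s) :=
  (differentiable_Gmat Q A).continuous.continuousAt.eventually (Units.isOpen.mem_nhds h)

end

/-- If every `αᵢ > 0`, `ς̄` is a critical point of `P^d` and `G(ς̄)` is positive definite,
then `ς̄` is a global maximizer of `P^d` over `S_a⁺ = {ς : G(ς) ≻ 0}`. -/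
theorem global_max_of_dual {n m : ℕ} (Q : Matrix (Fin n) (Fin n) ℝ)
    (A : Fin m → Matrix (Fin n) (Fin n) ℝ) (f : Fin n → ℝ) (b : Fin m → Fin n → ℝ)
    (c α : Fin m → ℝ) (hQ : Q.IsSymm) (hA : ∀ i, (A i).IsSymm)
    (hα : ∀ i, 0 < α i) (ςb : Fin m → ℝ)
    (hcrit : fderiv ℝ (dualP Q A f b c α) ςb = 0)
    (hG : (Gmat Q A ςb).PosDef) :
    ∀ ς : Fin m → ℝ, (Gmat Q A ς).PosDef →
      dualP Q A f b c α ς ≤ dualP Q A f b c α ςb := by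
  have hu : IsUnit (Gmat Q A ςb) := hG.isUnit
  have hdet : ∀ s, IsUnit (Gmat Q A s) → IsUnit (Gmat Q A s).det := fun s hs =>
    (Matrix.isUnit_iff_isUnit_det _).1 hs
  set x : Fin n → ℝ := (Gmat Q A ςb)⁻¹.mulVec (Fvec f b ςb) with hx
  let u : Fin n → (Fin m → ℝ) → ℝ := fun i s =>
    (x - (Gmat Q A s)⁻¹.mulVec (Fvec f b s)) i
  let v : Fin n → (Fin m → ℝ) → ℝ := fun i s =>
    (Gmat Q A s).mulVec (x - (Gmat Q A s)⁻¹.mulVec (Fvec f b s)) i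
  have hu0 : ∀ i, u i ςb = 0 := fun i => by simp [u, hx]
  have hv0 : ∀ i, v i ςb = 0 := fun i => by simp [v, ← hx]
  have hud : ∀ i, DifferentiableAt ℝ (u i) ςb := by
    intro i
    have hF : ∀ j, DifferentiableAt ℝ (fun s => Fvec f b s j) ςb := by
      intro j
      simp only [Fvec, Pi.sub_apply, Finset.sum_apply, Pi.smul_apply, smul_eq_mul]
      fun_prop
    have := entry_Ginv Q A ςb hu
    have hu' : u i = fun s => x i - ∑ j, (Gmat Q A s)⁻¹ i j * Fvec f b s j := rfl
    rw [hu']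
    exact (differentiableAt_const _).sub
      (DifferentiableAt.fun_sum fun j _ => (this i j).mul (hF j))
  have hvd : ∀ i, DifferentiableAt ℝ (v i) ςb := by
    intro i
    have hGd := entry_G Q A ςb
    have : v i = fun s => ∑ j, Gmat Q A s i j * u j s := rfl
    rw [this]
    exact DifferentiableAt.fun_sum fun j _ => (hGd i j).mul (hud j)
  have hR : HasFDerivAt (fun s => (1 / 2 : ℝ) * ∑ i, u i s * v i s)
      (0 : (Fin m → ℝ) →L[ℝ] ℝ) ςb := by
    have h1 : ∀ i ∈ Finset.univ, HasFDerivAt (fun s => u i s * v i s)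
        (0 : (Fin m → ℝ) →L[ℝ] ℝ) ςb := by
      intro i _
      have := (hud i).hasFDerivAt.mul (hvd i).hasFDerivAt
      simp only [hu0, hv0, zero_smul, add_zero] at this
      exact this
    have := (HasFDerivAt.fun_sum h1).const_mul (1 / 2 : ℝ)
    simpa using this
  let w : Fin m → ℝ := fun i => c i + b i ⬝ᵥ x + (1 / 2) * (x ⬝ᵥ (A i).mulVec x)
  have hh : HasFDerivAt (hsep Q A f b c α x)
      (∑ i, (w i - ςb i / α i) • ContinuousLinearMap.proj (R := ℝ) (φ := fun _ : Fin m => ℝ) i)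
      ςb := by
    unfold hsep
    refine HasFDerivAt.add_const _ (HasFDerivAt.fun_sum fun i _ => ?_)
    have hp : HasFDerivAt (fun s : Fin m → ℝ => s i)
      (ContinuousLinearMap.proj (R := ℝ) (φ := fun _ : Fin m => ℝ) i) ςb := hasFDerivAt_apply i ςb
    have hg : HasDerivAt (fun t : ℝ => w i * t - t ^ 2 / (2 * α i)) (w i - ςb i / α i)
        (ςb i) := by
      have h2 := ((hasDerivAt_id (ςb i)).const_mul (w i)).sub
        (((hasDerivAt_id (ςb i)).pow 2).div_const (2 * α i))
      have h3 : w i - ςb i / α i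
          = w i * 1 - ((2 : ℕ) : ℝ) * (id (ςb i)) ^ (2 - 1) * 1 / (2 * α i) := by
        have := (hα i).ne'
        norm_num
        field_simp
      rw [h3]
      exact h2
    exact hg.comp_hasFDerivAt ςb hp
  have hev : dualP Q A f b c α =ᶠ[nhds ςb]
      fun s => hsep Q A f b c α x s - (1 / 2 : ℝ) * ∑ i, u i s * v i s := by
    filter_upwards [eventually_unit Q A ςb hu] with s hs
    exact dual_eq Q A f b c α hQ hA x s (hdet s hs)
  have hD := (hh.sub hR).congr_of_eventuallyEq hev
  have hzero := hD.fderiv.symm.trans hcrit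
  have hw : ∀ i, w i = ςb i / α i := by
    intro i
    have := congrArg (fun L : (Fin m → ℝ) →L[ℝ] ℝ => L (Pi.single i 1)) hzero
    simp [Pi.single_apply] at this
    linarith
  intro ς hς
  have e1 := dual_eq Q A f b c α hQ hA x ςb (hdet _ hu)
  have e2 := dual_eq Q A f b c α hQ hA x ς (hdet _ hς.isUnit)
  rw [← hx] at e1
  simp only [sub_self, zero_dotProduct, mul_zero, sub_zero] at e1
  have hnn := hς.posSemidef.dotProduct_mulVec_nonneg (x - (Gmat Q A ς)⁻¹.mulVec (Fvec f b ς))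
  simp only [star_trivial] at hnn
  have hle : hsep Q A f b c α x ς ≤ hsep Q A f b c α x ςb := by
    unfold hsep
    refine add_le_add (Finset.sum_le_sum fun i _ => ?_) le_rfl
    change w i * ς i - ς i ^ 2 / (2 * α i) ≤ w i * ςb i - ςb i ^ 2 / (2 * α i)
    rw [hw i]
    have ha := hα i
    have : ςb i / α i * ςb i - ςb i ^ 2 / (2 * α i) - (ςb i / α i * ς i - ς i ^ 2 / (2 * α i))
      = (ςb i - ς i) ^ 2 / (2 * α i) := by field_simp; ring
    have : 0 ≤ (ςb i - ς i) ^ 2 / (2 * α i) := by positivity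
    linarith
  rw [e1, e2]
  linarith
end

section
/- Suppose every α_i > 0. Then the canonical dual function P^d is concave on the convex set S_a⁺ = {ς ∈ ℝ^m : G(ς) is positive definite}: for all ς₁, ς₂ ∈ S_a⁺ and t ∈ [0,1], P^d(t·ς₁ + (1−t)·ς₂) ≥ t·P^d(ς₁) + (1−t)·P^d(ς₂). -/
open Matrix

theorem aux_inv_mul {n : ℕ} {G : Matrix (Fin n) (Fin n) ℝ} (hG : G.PosDef) (F : Fin n → ℝ) :
    G *ᵥ (G⁻¹ *ᵥ F) = F := by
  have hu : IsUnit G.det := (Matrix.isUnit_iff_isUnit_det _).1 hG.isUnit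
  rw [Matrix.mulVec_mulVec, Matrix.mul_nonsing_inv _ hu, Matrix.one_mulVec]

theorem aux_le {n : ℕ} {G : Matrix (Fin n) (Fin n) ℝ} (hG : G.PosDef) (F x : Fin n → ℝ) :
    2 * (x ⬝ᵥ F) - x ⬝ᵥ G *ᵥ x ≤ F ⬝ᵥ G⁻¹ *ᵥ F := by
  have hy := aux_inv_mul hG F
  set y := G⁻¹ *ᵥ F with hyd
  have hs : Gᵀ = G := by
    have := hG.isHermitian.eq
    rwa [Matrix.conjTranspose_eq_transpose_of_trivial] at this
  have h := hG.posSemidef.dotProduct_mulVec_nonneg (x - y)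
  have h1 : y ⬝ᵥ G *ᵥ x = x ⬝ᵥ F := by
    rw [Matrix.dotProduct_mulVec, ← Matrix.mulVec_transpose, hs, hy, dotProduct_comm]
  have h2 : F ⬝ᵥ y = y ⬝ᵥ F := dotProduct_comm _ _
  simp only [star_trivial, Matrix.mulVec_sub, dotProduct_sub, sub_dotProduct, hy, h1] at h
  linarith

theorem aux_G {n m : ℕ} (Q : Matrix (Fin n) (Fin n) ℝ)
    (A : Fin m → Matrix (Fin n) (Fin n) ℝ) (u v : Fin m → ℝ) (t : ℝ) :
    Gmat Q A (t • u + (1 - t) • v) = t • Gmat Q A u + (1 - t) • Gmat Q A v := by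
  simp only [Gmat, Pi.add_apply, Pi.smul_apply, add_smul, Finset.sum_add_distrib, smul_add,
    Finset.smul_sum, smul_assoc]
  module

theorem aux_F {n m : ℕ} (f : Fin n → ℝ) (b : Fin m → Fin n → ℝ) (u v : Fin m → ℝ) (t : ℝ) :
    Fvec f b (t • u + (1 - t) • v) = t • Fvec f b u + (1 - t) • Fvec f b v := by
  simp only [Fvec, Pi.add_apply, Pi.smul_apply, add_smul, Finset.sum_add_distrib, smul_sub,
    Finset.smul_sum, smul_assoc]
  module

theorem aux_sum {m : ℕ} (c α u v : Fin m → ℝ) (hα : ∀ i, 0 < α i) (t : ℝ) (h0 : 0 ≤ t)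
    (h1 : t ≤ 1) :
    t * (∑ i, (c i * u i - u i ^ 2 / (2 * α i))) + (1 - t) * (∑ i, (c i * v i - v i ^ 2 / (2 * α i)))
      ≤ ∑ i, (c i * (t • u + (1 - t) • v) i - (t • u + (1 - t) • v) i ^ 2 / (2 * α i)) := by
  rw [Finset.mul_sum, Finset.mul_sum, ← Finset.sum_add_distrib]
  refine Finset.sum_le_sum fun i _ => ?_
  simp only [Pi.add_apply, Pi.smul_apply, smul_eq_mul]
  have ha : 0 < (2 * α i)⁻¹ := inv_pos.2 (by linarith [hα i])
  simp only [div_eq_mul_inv]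
  have h := mul_nonneg (mul_nonneg (mul_nonneg h0 (sub_nonneg.2 h1)) ha.le) (sq_nonneg (u i - v i))
  nlinarith [h]

/-- If every `αᵢ > 0`, the canonical dual function `P^d` is concave on
`S_a⁺ = {ς : G(ς) ≻ 0}`. -/
theorem dual_concave_on_Sa_plus {n m : ℕ} (Q : Matrix (Fin n) (Fin n) ℝ)
    (A : Fin m → Matrix (Fin n) (Fin n) ℝ) (f : Fin n → ℝ) (b : Fin m → Fin n → ℝ)
    (c α : Fin m → ℝ) (hQ : Q.IsSymm) (hA : ∀ i, (A i).IsSymm)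
    (hα : ∀ i, 0 < α i) :
    ∀ ς₁ ∈ {ς : Fin m → ℝ | (Gmat Q A ς).PosDef},
      ∀ ς₂ ∈ {ς : Fin m → ℝ | (Gmat Q A ς).PosDef},
        ∀ t : ℝ, 0 ≤ t → t ≤ 1 →
          t * dualP Q A f b c α ς₁ + (1 - t) * dualP Q A f b c α ς₂ ≤
            dualP Q A f b c α (t • ς₁ + (1 - t) • ς₂) := by
  intro u hu v hv t h0 h1
  simp only [Set.mem_setOf_eq] at hu hv
  have hw : (Gmat Q A (t • u + (1 - t) • v)).PosDef := by
    rw [aux_G]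
    rcases h0.eq_or_lt with h | h
    · subst h
      simpa using hv
    · exact (hu.smul h).add_posSemidef (hv.posSemidef.smul (sub_nonneg.2 h1))
  have hs := aux_sum c α u v hα t h0 h1
  have he := aux_inv_mul hw (Fvec f b (t • u + (1 - t) • v))
  unfold dualP
  set x := (Gmat Q A (t • u + (1 - t) • v))⁻¹ *ᵥ (Fvec f b (t • u + (1 - t) • v)) with hx
  have e1 := mul_le_mul_of_nonneg_left (aux_le hu (Fvec f b u) x) h0
  have e2 := mul_le_mul_of_nonneg_left (aux_le hv (Fvec f b v) x) (sub_nonneg.2 h1)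
  have e3 : x ⬝ᵥ Gmat Q A (t • u + (1 - t) • v) *ᵥ x = x ⬝ᵥ Fvec f b (t • u + (1 - t) • v) := by
    rw [he]
  have e4 : Fvec f b (t • u + (1 - t) • v) ⬝ᵥ x = x ⬝ᵥ Fvec f b (t • u + (1 - t) • v) :=
    dotProduct_comm _ _
  rw [e4]
  clear_value x
  rw [aux_G, aux_F] at e3
  rw [aux_F]
  simp only [Matrix.add_mulVec, Matrix.smul_mulVec, dotProduct_add, dotProduct_smul,
    smul_eq_mul] at e3 ⊢
  linarith
end
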